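/- Let N ⊆ ℝ^d be a Lebesgue-null set and let γ : ℝ^d \ N → ℝ^d and, for i,j = 1,…,d, η_{i,j} : ℝ^d \ N → ℝ^d be measurable and locally bounded with η_{i,j} = η_{j,i}. Let g : [0,∞) × ℝ^d → ℝ be of class C^{1,2} (continuously differentiable in the first variable x and twice continuously differentiable in the second variable y, with these partial derivatives jointly continuous) and suppose that for all x ≥ 0 and all y ∈ ℝ^d \ N: ∂_{y_i}∂_{y_j} g(x,y) = ∇_y g(x,y)·η_{i,j}(y) for all i,j = 1,…,d, and ∂_x g(x,y) = ∇_y g(x,y)·γ(y). Then there exist a function c : [0,∞) → ℝ, a function u : [0,∞) → ℝ^d, and a twice continuously differentiable function A : ℝ^d → ℝ^d with A(0) = 0 such that g(x,y) = c(x) + u(x)·A(y) for all x ≥ 0 and all y ∈ ℝ^d, and moreover c, u_1, …, u_d are quasi-exponential functions. -/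

import Mathlib

open MeasureTheory
open scoped RealInnerProductSpace

/-- A function `f : ℝ → ℝ` is quasi-exponential on a set `s` if on `s` it is a finite sum
`Σ_j e^{α_j x}(p_j(x)cos(ω_j x) + q_j(x)sin(ω_j x))` with `α_j, ω_j ∈ ℝ` and real
polynomials `p_j, q_j`. -/
def IsQuasiExponentialOn (f : ℝ → ℝ) (s : Set ℝ) : Prop :=
  ∃ (n : ℕ) (α ω : Fin n → ℝ) (p q : Fin n → Polynomial ℝ),
    ∀ x ∈ s, f x = ∑ j, Real.exp (α j * x) *
      ((p j).eval x * Real.cos (ω j * x) + (q j).eval x * Real.sin (ω j * x))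

theorem qe_add {f g : ℝ → ℝ} {s : Set ℝ} (hf : IsQuasiExponentialOn f s)
    (hg : IsQuasiExponentialOn g s) : IsQuasiExponentialOn (fun x => f x + g x) s := by
  obtain ⟨n, α, ω, p, q, h⟩ := hf
  obtain ⟨n', α', ω', p', q', h'⟩ := hg
  refine ⟨n + n', Fin.append α α', Fin.append ω ω', Fin.append p p', Fin.append q q', ?_⟩
  intro x hx
  simp [Fin.sum_univ_add, h x hx, h' x hx]

theorem dual_repr {ι V : Type*} [Fintype ι] [AddCommGroup V] [Module ℝ V]
    (b : Module.Basis ι ℝ (Module.Dual ℝ V)) (φ : Module.Dual ℝ V) (v : V) :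
    φ v = ∑ i, b.repr φ i * b i v := by
  have h := LinearMap.congr_fun (b.sum_repr φ) v
  rw [← h, LinearMap.sum_apply]
  rfl

theorem exists_pseudo_inv {V W : Type*} [AddCommGroup V] [Module ℝ V] [AddCommGroup W]
    [Module ℝ W] (f : V →ₗ[ℝ] W) : ∃ S : W →ₗ[ℝ] V, ∀ v, f (S (f v)) = f v := by
  obtain ⟨R, hR⟩ := f.rangeRestrict.exists_rightInverse_of_surjective f.range_rangeRestrict
  obtain ⟨S, hS⟩ := R.exists_extend
  refine ⟨S, fun v => ?_⟩
  have h1 := LinearMap.congr_fun hS (f.rangeRestrict v)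
  have h2 := LinearMap.congr_fun hR (f.rangeRestrict v)
  have h3 : S (f v) = R (f.rangeRestrict v) := h1
  rw [h3]
  exact congrArg Subtype.val h2

theorem cont_norm_fderiv {E F : Type*} [NormedAddCommGroup E] [NormedSpace ℝ E]
    [NormedAddCommGroup F] [NormedSpace ℝ F] {f : E → F} (hf : ContDiff ℝ 1 f) :
    Continuous (fun z => ‖fderiv ℝ f z‖) :=
  (hf.continuous_fderiv (by norm_num)).norm

theorem poly_antideriv (p : Polynomial ℝ) : ∃ P : Polynomial ℝ, P.derivative = p := by
  induction p using Polynomial.induction_on' with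
  | add p q hp hq =>
    obtain ⟨P, rfl⟩ := hp
    obtain ⟨Q, rfl⟩ := hq
    exact ⟨P + Q, by simp⟩
  | monomial n a =>
    refine ⟨Polynomial.monomial (n + 1) (a / (n + 1)), ?_⟩
    rw [Polynomial.derivative_monomial]
    have : (n : ℝ) + 1 ≠ 0 := by positivity
    simp [this]

theorem const_on_Ici {F : ℝ → ℂ} (h : ∀ x ≥ (0:ℝ), HasDerivWithinAt F 0 (Set.Ici 0) x) :
    ∀ x ≥ (0:ℝ), F x = F 0 := by
  intro x hx
  refine constant_of_has_deriv_right_zero (a := 0) (b := x) ?_ ?_ x ⟨hx, le_rfl⟩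
  · intro t ht
    exact (h t ht.1).continuousWithinAt.mono Set.Icc_subset_Ici_self
  · intro t ht
    exact (h t ht.1).mono (Set.Ici_subset_Ici.2 ht.1)

theorem gen_eig {V : Type*} [AddCommGroup V] [Module ℂ V] (D : Module.End ℂ V)
    (Φ : V →ₗ[ℂ] (ℝ → ℂ))
    (hΦ : ∀ v, ∀ x ≥ (0:ℝ), HasDerivWithinAt (Φ v) (Φ (D v) x) (Set.Ici 0) x) (μ : ℂ) (k : ℕ) :
    ∀ v, ((D - μ • (1 : Module.End ℂ V)) ^ k) v = 0 →
      ∃ a b : Polynomial ℝ, ∀ x ≥ (0:ℝ), Φ v x =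
        Complex.exp (μ * x) * ((a.eval x : ℝ) + (b.eval x : ℝ) * Complex.I) := by
  induction k with
  | zero =>
    intro v hv
    refine ⟨0, 0, ?_⟩
    intro x _
    have : v = 0 := by simpa using hv
    simp [this]
  | succ k ih =>
    intro v hv
    obtain ⟨a, b, hab⟩ := ih ((D - μ • (1 : Module.End ℂ V)) v) (by
      rw [pow_succ] at hv; exact hv)
    obtain ⟨P, rfl⟩ := poly_antideriv a
    obtain ⟨Q, rfl⟩ := poly_antideriv b
    set F : ℝ → ℂ := fun x => Complex.exp (-(μ * x)) * Φ v x -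
      ((P.eval x : ℝ) + (Q.eval x : ℝ) * Complex.I) with hF
    have hE : ∀ x : ℝ, HasDerivAt (fun x : ℝ => Complex.exp (-(μ * x)))
        (Complex.exp (-(μ * x)) * (-μ)) x := by
      intro x
      have h1 : HasDerivAt (fun x : ℝ => -(μ * (x:ℂ))) (-(μ * 1)) x :=
        ((HasDerivAt.ofReal_comp (hasDerivAt_id x)).const_mul μ).neg
      simpa using h1.cexp
    have hc : ∀ x ≥ (0:ℝ), F x = F 0 := by
      apply const_on_Ici
      intro x hx
      have hP : HasDerivAt (fun x : ℝ => ((P.eval x : ℝ) : ℂ)) ((P.derivative.eval x : ℝ) : ℂ) x :=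
        (P.hasDerivAt x).ofReal_comp
      have hQ : HasDerivAt (fun x : ℝ => ((Q.eval x : ℝ) : ℂ)) ((Q.derivative.eval x : ℝ) : ℂ) x :=
        (Q.hasDerivAt x).ofReal_comp
      have := ((hE x).hasDerivWithinAt.mul (hΦ v x hx)).sub
        (hP.add (hQ.mul_const Complex.I)).hasDerivWithinAt (s := Set.Ici 0)
      refine this.congr_deriv ?_
      have h2 := hab x hx
      simp only [LinearMap.sub_apply, map_sub, Pi.sub_apply, LinearMap.smul_apply,
        Module.End.one_apply, map_smul, Pi.smul_apply, smul_eq_mul] at h2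
      have h3 : Φ (D v) x = μ * Φ v x + Complex.exp (μ * x) *
        ((P.derivative.eval x : ℝ) + (Q.derivative.eval x : ℝ) * Complex.I) := by
        rw [← h2]; ring
      rw [h3, Complex.exp_neg]
      field_simp [Complex.exp_ne_zero]
      ring
    refine ⟨P + Polynomial.C (F 0).re, Q + Polynomial.C (F 0).im, ?_⟩
    intro x hx
    have h4 := hc x hx
    have h5 : Φ v x = Complex.exp (μ * x) *
        (((P.eval x : ℝ) + (Q.eval x : ℝ) * Complex.I) + F 0) := by
      rw [← h4]
      simp only [hF]
      rw [Complex.exp_neg]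
      field_simp [Complex.exp_ne_zero]
      ring
    rw [h5]
    congr 1
    conv_lhs => rw [← Complex.re_add_im (F 0)]
    simp only [Polynomial.eval_add, Polynomial.eval_C, Complex.ofReal_add]
    ring

theorem qe_of_ode {ι : Type*} [Fintype ι] [DecidableEq ι] (f : ι → ℝ → ℝ) (M : ι → ι → ℝ)
    (h : ∀ i, ∀ x ≥ (0:ℝ), HasDerivWithinAt (f i) (∑ j, M i j * f j x) (Set.Ici 0) x) (v : ι → ℝ) :
    IsQuasiExponentialOn (fun x => ∑ i, v i * f i x) (Set.Ici 0) := by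
  let D : Module.End ℂ (ι → ℂ) := Matrix.toLin' (Matrix.of fun j i => (M i j : ℂ))
  let Φ : (ι → ℂ) →ₗ[ℂ] (ℝ → ℂ) :=
    { toFun := fun v x => ∑ i, v i * f i x
      map_add' := by intro v w; ext x; simp [add_mul, Finset.sum_add_distrib]
      map_smul' := by intro v w; ext x; simp [mul_assoc, Finset.mul_sum] }
  have hΦ : ∀ v, ∀ x ≥ (0:ℝ), HasDerivWithinAt (Φ v) (Φ (D v) x) (Set.Ici 0) x := by
    intro v x hx
    have h1 : HasDerivWithinAt (fun x => ∑ i, v i * (f i x : ℂ))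
        (∑ i, v i * ((∑ j, M i j * f j x : ℝ) : ℂ)) (Set.Ici 0) x :=
      HasDerivWithinAt.fun_sum fun i _ => ((h i x hx).ofReal_comp).const_mul (v i)
    refine h1.congr_deriv ?_
    simp only [Φ, D, LinearMap.coe_mk, AddHom.coe_mk, Matrix.toLin'_apply, Matrix.mulVec,
      dotProduct, Matrix.of_apply, Complex.ofReal_sum, Complex.ofReal_mul, Finset.mul_sum,
      Finset.sum_mul]
    rw [Finset.sum_comm]
    refine Finset.sum_congr rfl fun i _ => Finset.sum_congr rfl fun j _ => ?_
    ring
  have key : ∀ w : ι → ℂ, IsQuasiExponentialOn (fun x => (Φ w x).re) (Set.Ici 0) := by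
    intro w
    have hw : w ∈ ⨆ μ : ℂ, D.maxGenEigenspace μ := by
      rw [Module.End.iSup_maxGenEigenspace_eq_top]; trivial
    refine Submodule.iSup_induction (fun μ : ℂ => D.maxGenEigenspace μ)
      (motive := fun w => IsQuasiExponentialOn (fun x => (Φ w x).re) (Set.Ici 0)) hw ?_ ?_ ?_
    · intro μ w hw
      obtain ⟨k, hk⟩ := (Module.End.mem_maxGenEigenspace _ _ _).1 hw
      obtain ⟨a, b, hab⟩ := gen_eig D Φ hΦ μ k w hk
      refine ⟨1, fun _ => μ.re, fun _ => μ.im, fun _ => a, fun _ => -b, ?_⟩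
      intro x hx
      simp only [hab x hx, Finset.univ_unique, Finset.sum_const, Finset.card_singleton, one_smul]
      simp [Complex.exp_re, Complex.exp_im]
      ring
    · exact ⟨0, fun _ => 0, fun _ => 0, fun _ => 0, fun _ => 0, by simp⟩
    · intro a b ha hb
      simpa using qe_add ha hb
  have := key (fun i => (v i : ℂ))
  convert this using 2 with x
  simp [Φ]

section
variable {d : ℕ}
local notation "𝔼" => EuclideanSpace ℝ (Fin d)

theorem dense_compl_null (N : Set (EuclideanSpace ℝ (Fin d))) (hN : volume N = 0) :
    Dense Nᶜ := by
  rw [← interior_eq_empty_iff_dense_compl]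
  exact Measure.interior_eq_empty_of_null hN

theorem bilin_bound (B : 𝔼 →L[ℝ] 𝔼 →L[ℝ] ℝ) :
    ‖B‖ ≤ ∑ i, ∑ j, |B (EuclideanSpace.single i 1) (EuclideanSpace.single j 1)| := by
  have hs : ∀ a : 𝔼, a = ∑ i, a i • EuclideanSpace.single i (1:ℝ) := by
    intro a
    simpa using ((EuclideanSpace.basisFun (Fin d) ℝ).sum_repr a).symm
  refine B.opNorm_le_bound₂ (by positivity) ?_
  intro a b
  have : B a b = ∑ i, ∑ j, a i * b j *
      B (EuclideanSpace.single i 1) (EuclideanSpace.single j 1) := by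
    conv_lhs => rw [hs a, hs b]
    simp only [map_sum, map_smul, sum_apply, smul_apply,
      smul_eq_mul, Finset.mul_sum]
    rw [Finset.sum_comm]
    refine Finset.sum_congr rfl fun i _ => Finset.sum_congr rfl fun j _ => ?_
    ring
  rw [this, Finset.sum_mul, Finset.sum_mul]
  refine (norm_sum_le _ _).trans (Finset.sum_le_sum fun i _ => ?_)
  rw [Finset.sum_mul, Finset.sum_mul]
  refine (norm_sum_le _ _).trans (Finset.sum_le_sum fun j _ => ?_)
  rw [norm_mul, norm_mul, Real.norm_eq_abs (B _ _), mul_comm, mul_assoc]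
  gcongr
  · exact PiLp.norm_apply_le a i
  · exact PiLp.norm_apply_le b j

theorem grad_zero (N : Set 𝔼) (hN : volume N = 0) (η : Fin d → Fin d → 𝔼 → 𝔼)
    (hη : ∀ i j, ∀ B : Set 𝔼, Bornology.IsBounded B → ∃ C : ℝ, ∀ y ∈ B \ N, ‖η i j y‖ ≤ C)
    (h : 𝔼 → ℝ) (hh : ContDiff ℝ 2 h)
    (hp : ∀ y ∉ N, ∀ i j, fderiv ℝ (fderiv ℝ h) y (EuclideanSpace.single i 1)
      (EuclideanSpace.single j 1) = fderiv ℝ h y (η i j y))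
    (h0 : fderiv ℝ h 0 = 0) : ∀ y, h y = h 0 := by
  have hD : ContDiff ℝ 1 (fderiv ℝ h) := hh.fderiv_right (by norm_num)
  have hz : ∀ y, fderiv ℝ h y = 0 := by
    intro y
    choose C hC using fun i j => hη i j (Metric.ball 0 (‖y‖ + 1)) Metric.isBounded_ball
    have hb : ∀ z ∈ Metric.ball (0:𝔼) (‖y‖ + 1),
        ‖fderiv ℝ (fderiv ℝ h) z‖ ≤ (∑ i, ∑ j, C i j) * ‖fderiv ℝ h z‖ := by
      have hn2 : Continuous (fun z : 𝔼 => ‖fderiv ℝ (fderiv ℝ h) z‖) := 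
        cont_norm_fderiv hD
      have hcl : IsClosed {z : 𝔼 | ‖fderiv ℝ (fderiv ℝ h) z‖ ≤
          (∑ i, ∑ j, C i j) * ‖fderiv ℝ h z‖} :=
        isClosed_le hn2
          (continuous_const.mul (continuous_norm.comp hD.continuous))
      have hsub : Metric.ball (0:𝔼) (‖y‖ + 1) ∩ Nᶜ ⊆ {z : 𝔼 | ‖fderiv ℝ (fderiv ℝ h) z‖ ≤
          (∑ i, ∑ j, C i j) * ‖fderiv ℝ h z‖} := by
        rintro z ⟨hz1, hz2⟩
        refine (bilin_bound _).trans ?_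
        rw [Finset.sum_mul]
        refine Finset.sum_le_sum fun i _ => ?_
        rw [Finset.sum_mul]
        refine Finset.sum_le_sum fun j _ => ?_
        rw [hp z hz2, mul_comm]
        refine ((fderiv ℝ h z).le_opNorm _).trans ?_
        gcongr
        exact hC i j z ⟨hz1, hz2⟩
      intro z hz
      have := (dense_compl_null N hN).open_subset_closure_inter (Metric.isOpen_ball) hz
      exact closure_minimal hsub hcl this
    have hder : ∀ t : ℝ, HasDerivAt (fun t : ℝ => fderiv ℝ h (t • y))
        (fderiv ℝ (fderiv ℝ h) (t • y) y) t := by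
      intro t
      have h1 : HasDerivAt (fun t : ℝ => t • y) y t := by
        simpa using (hasDerivAt_id t).smul_const y
      exact ((hD.differentiable (by norm_num)) (t • y)).hasFDerivAt.comp_hasDerivAt t h1
    have := eq_zero_of_abs_deriv_le_mul_abs_self_of_eq_zero_right
      (f := fun t : ℝ => fderiv ℝ h (t • y)) (f' := fun t => fderiv ℝ (fderiv ℝ h) (t • y) y)
      (K := (∑ i, ∑ j, C i j) * ‖y‖) (a := 0) (b := 1)
      (fun t _ => (hder t).continuousAt.continuousWithinAt)
      (fun t _ => (hder t).hasDerivWithinAt) (by simpa using h0)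
      (by
        intro t ht
        refine ((fderiv ℝ (fderiv ℝ h) (t • y)).le_opNorm y).trans ?_
        rw [mul_right_comm]
        gcongr
        apply hb
        rw [mem_ball_zero_iff, norm_smul, Real.norm_of_nonneg ht.1]
        nlinarith [norm_nonneg y, ht.1, ht.2])
      1 ⟨zero_le_one, le_rfl⟩
    simpa using this
  intro y
  exact is_const_of_fderiv_eq_zero (hh.differentiable (by norm_num)) hz y 0

/-- The space of `C²` solutions of the second-order system. -/
def solSpace (N : Set (EuclideanSpace ℝ (Fin d)))
    (η : Fin d → Fin d → EuclideanSpace ℝ (Fin d) → EuclideanSpace ℝ (Fin d)) :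
    Submodule ℝ (EuclideanSpace ℝ (Fin d) → ℝ) where
  carrier := {h | ContDiff ℝ 2 h ∧ ∀ y ∉ N, ∀ i j, fderiv ℝ (fderiv ℝ h) y
    (EuclideanSpace.single i 1) (EuclideanSpace.single j 1) = fderiv ℝ h y (η i j y)}
  zero_mem' := by
    refine ⟨contDiff_const, ?_⟩
    intro y _ i j
    have : fderiv ℝ (0 : 𝔼 → ℝ) = 0 := by ext1 z; simp
    rw [this]; simp
  add_mem' := by
    rintro f g ⟨hf, hf'⟩ ⟨hg, hg'⟩
    refine ⟨hf.add hg, ?_⟩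
    intro y hy i j
    have h1 : fderiv ℝ (f + g) = fderiv ℝ f + fderiv ℝ g := by
      ext1 z
      exact fderiv_add (hf.differentiable (by norm_num) z) (hg.differentiable (by norm_num) z)
    have hDf : ContDiff ℝ 1 (fderiv ℝ f) := hf.fderiv_right (by norm_num)
    have hDg : ContDiff ℝ 1 (fderiv ℝ g) := hg.fderiv_right (by norm_num)
    rw [h1, fderiv_add (hDf.differentiable (by norm_num) y) (hDg.differentiable (by norm_num) y)]
    simp [hf' y hy, hg' y hy]
  smul_mem' := by
    rintro c f ⟨hf, hf'⟩
    refine ⟨hf.const_smul c, ?_⟩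
    intro y hy i j
    have h1 : fderiv ℝ (c • f) = c • fderiv ℝ f := by
      ext1 z
      exact fderiv_const_smul (hf.differentiable (by norm_num) z) c
    have hDf : ContDiff ℝ 1 (fderiv ℝ f) := hf.fderiv_right (by norm_num)
    rw [h1, fderiv_const_smul (hDf.differentiable (by norm_num) y)]
    simp [hf' y hy]

variable (N : Set (EuclideanSpace ℝ (Fin d)))
    (η : Fin d → Fin d → EuclideanSpace ℝ (Fin d) → EuclideanSpace ℝ (Fin d))

/-- Evaluation at a point. -/
def evL (y : EuclideanSpace ℝ (Fin d)) : solSpace N η →ₗ[ℝ] ℝ where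
  toFun h := h.1 y
  map_add' := by intros; rfl
  map_smul' := by intros; rfl

/-- Derivative at a point. -/
noncomputable def dL (y : EuclideanSpace ℝ (Fin d)) :
    solSpace N η →ₗ[ℝ] (EuclideanSpace ℝ (Fin d) →L[ℝ] ℝ) where
  toFun h := fderiv ℝ h.1 y
  map_add' f g := fderiv_add (f.2.1.differentiable (by norm_num) y)
    (g.2.1.differentiable (by norm_num) y)
  map_smul' c f := fderiv_const_smul (f.2.1.differentiable (by norm_num) y) c

end

/-- Under the hypotheses of Statement 4 together with the first-order
equation `∂_x g(x,y) = ∇_y g(x,y) ⬝ γ(y)` (with `γ` measurable and locally bounded off the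
null set `N`), there exist `c : [0,∞) → ℝ`, `u : [0,∞) → ℝ^d` and a `C²` function
`A : ℝ^d → ℝ^d` with `A 0 = 0` such that `g(x,y) = c(x) + u(x) ⬝ A(y)` for all `x ≥ 0`,
`y ∈ ℝ^d`, and `c, u_1, …, u_d` are quasi-exponential. -/
theorem stmt5 (d : ℕ)
    (N : Set (EuclideanSpace ℝ (Fin d))) (hN : volume N = 0)
    (γ : EuclideanSpace ℝ (Fin d) → EuclideanSpace ℝ (Fin d))
    (hγ_meas : Measurable γ)
    (hγ_locbdd : ∀ B : Set (EuclideanSpace ℝ (Fin d)), Bornology.IsBounded B →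
      ∃ C : ℝ, ∀ y ∈ B \ N, ‖γ y‖ ≤ C)
    (η : Fin d → Fin d → EuclideanSpace ℝ (Fin d) → EuclideanSpace ℝ (Fin d))
    (hη_meas : ∀ i j, Measurable (η i j))
    (hη_locbdd : ∀ i j, ∀ B : Set (EuclideanSpace ℝ (Fin d)), Bornology.IsBounded B →
      ∃ C : ℝ, ∀ y ∈ B \ N, ‖η i j y‖ ≤ C)
    (hη_symm : ∀ i j, ∀ y ∉ N, η i j y = η j i y)
    (g : ℝ → EuclideanSpace ℝ (Fin d) → ℝ)
    -- g is C^{1,2}: C¹ in x, C² in y, with jointly continuous partial derivatives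
    (hg_x : ∀ y, ContDiffOn ℝ 1 (fun x => g x y) (Set.Ici 0))
    (hg_y : ∀ x, ContDiff ℝ 2 (g x))
    (hg_joint_x : ContinuousOn
      (fun p : ℝ × EuclideanSpace ℝ (Fin d) =>
        derivWithin (fun x => g x p.2) (Set.Ici 0) p.1)
      (Set.Ici 0 ×ˢ Set.univ))
    (hg_joint_y : ContinuousOn
      (fun p : ℝ × EuclideanSpace ℝ (Fin d) => gradient (g p.1) p.2)
      (Set.Ici 0 ×ˢ Set.univ))
    (hg_joint_yy : ∀ i j, ContinuousOn
      (fun p : ℝ × EuclideanSpace ℝ (Fin d) =>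
        fderiv ℝ (fun z => fderiv ℝ (g p.1) z (EuclideanSpace.single j 1)) p.2
          (EuclideanSpace.single i 1))
      (Set.Ici 0 ×ˢ Set.univ))
    (hpde_yy : ∀ x ≥ (0:ℝ), ∀ y ∉ N, ∀ i j,
      fderiv ℝ (fun z => fderiv ℝ (g x) z (EuclideanSpace.single j 1)) y
          (EuclideanSpace.single i 1)
        = ⟪gradient (g x) y, η i j y⟫)
    (hpde_x : ∀ x ≥ (0:ℝ), ∀ y ∉ N,
      derivWithin (fun x' => g x' y) (Set.Ici 0) x = ⟪gradient (g x) y, γ y⟫) :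
    ∃ (c : ℝ → ℝ) (u : ℝ → EuclideanSpace ℝ (Fin d))
      (A : EuclideanSpace ℝ (Fin d) → EuclideanSpace ℝ (Fin d)),
      ContDiff ℝ 2 A ∧ A 0 = 0 ∧
      (∀ x ≥ (0:ℝ), ∀ y, g x y = c x + ⟪u x, A y⟫) ∧
      IsQuasiExponentialOn c (Set.Ici 0) ∧
      ∀ i : Fin d, IsQuasiExponentialOn (fun x => u x i) (Set.Ici 0) := by
  have hdense := dense_compl_null N hN
  have hmem : ∀ x ≥ (0:ℝ), g x ∈ solSpace N η := by
    intro x hx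
    refine ⟨hg_y x, ?_⟩
    intro y hy i j
    have h1 := hpde_yy x hx y hy i j
    rw [inner_gradient_left] at h1
    rw [← h1]
    have hD : ContDiff ℝ 1 (fderiv ℝ (g x)) := (hg_y x).fderiv_right (by norm_num)
    rw [fderiv_clm_apply (hD.differentiable (by norm_num) y) (differentiableAt_const _)]
    simp
  have hzero : ∀ h : solSpace N η, dL N η 0 h = 0 → ∀ y, h.1 y = h.1 0 := fun h hh =>
    grad_zero N hN η hη_locbdd h.1 h.2.1 h.2.2 hh
  -- finite dimensionality
  have hfin : FiniteDimensional ℝ (solSpace N η) := by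
    refine FiniteDimensional.of_injective ((dL N η 0).prod (evL N η 0)) ?_
    rw [injective_iff_map_eq_zero]
    intro h hh
    have h1 : dL N η 0 h = 0 := congrArg Prod.fst hh
    have h2 : h.1 0 = 0 := congrArg Prod.snd hh
    ext y
    rw [hzero h h1 y, h2]; rfl
  let G : ℝ → solSpace N η := fun x => ⟨g (max x 0), hmem _ (le_max_right _ _)⟩
  have hG : ∀ x ≥ (0:ℝ), (G x).1 = g x := by
    intro x hx; simp [G, max_eq_left hx]
  -- derivative of functionals
  have hspan : Submodule.span ℝ (Set.range fun y : (Nᶜ : Set _) => evL N η y.1) = ⊤ := by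
    have h1 : (Submodule.span ℝ (Set.range fun y : (Nᶜ : Set _) => evL N η y.1) :
        Submodule ℝ (Module.Dual ℝ (solSpace N η))).dualCoannihilator = ⊥ := by
      rw [eq_bot_iff]
      intro h hh
      rw [Submodule.mem_dualCoannihilator] at hh
      rw [Submodule.mem_bot]
      apply Subtype.ext
      refine Continuous.ext_on hdense h.2.1.continuous continuous_const ?_
      intro y hy
      exact hh _ (Submodule.subset_span ⟨⟨y, hy⟩, rfl⟩)
    rw [← Subspace.dualCoannihilator_dualAnnihilator_eq (W := Submodule.span ℝ _), h1,
      Submodule.dualAnnihilator_bot]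
  have hder : ∀ φ : Module.Dual ℝ (solSpace N η), ∃ ψ : Module.Dual ℝ (solSpace N η),
      ∀ x ≥ (0:ℝ), HasDerivWithinAt (fun x => φ (G x)) (ψ (G x)) (Set.Ici 0) x := by
    intro φ
    have hφ : φ ∈ Submodule.span ℝ (Set.range fun y : (Nᶜ : Set _) => evL N η y.1) := by
      rw [hspan]; trivial
    induction hφ using Submodule.span_induction with
    | mem φ hφ =>
      obtain ⟨⟨y, hy⟩, rfl⟩ := hφ
      refine ⟨(ContinuousLinearMap.apply ℝ ℝ (γ y)).toLinearMap ∘ₗ dL N η y, ?_⟩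
      intro x hx
      have h1 := ((hg_x y).differentiableOn (by norm_num) x hx).hasDerivWithinAt
      rw [hpde_x x hx y hy, inner_gradient_left] at h1
      have h2 : HasDerivWithinAt (fun x => evL N η y (G x)) (fderiv ℝ (g x) y (γ y))
          (Set.Ici 0) x := by
        refine h1.congr ?_ ?_
        · intro t ht
          exact congrFun (hG t ht) y
        · exact congrFun (hG x hx) y
      refine h2.congr_deriv ?_
      rw [← hG x hx]; rfl
    | zero => exact ⟨0, fun x _ => by simpa using hasDerivWithinAt_const x _ (0:ℝ)⟩
    | add a b _ _ ha hb =>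
      obtain ⟨a', ha⟩ := ha
      obtain ⟨b', hb⟩ := hb
      exact ⟨a' + b', fun x hx => (ha x hx).add (hb x hx)⟩
    | smul c a _ ha =>
      obtain ⟨a', ha⟩ := ha
      exact ⟨c • a', fun x hx => (ha x hx).const_mul c⟩
  have hqe : ∀ φ : Module.Dual ℝ (solSpace N η),
      IsQuasiExponentialOn (fun x => φ (G x)) (Set.Ici 0) := by
    intro φ
    let b := Module.finBasis ℝ (Module.Dual ℝ (solSpace N η))
    choose ψ hψ using hder
    have := qe_of_ode (fun i x => b i (G x)) (fun i j => b.repr (ψ (b i)) j) (by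
      intro i x hx
      refine (hψ (b i) x hx).congr_deriv ?_
      exact dual_repr b _ _) (fun i => b.repr φ i)
    convert this using 2 with x
    exact dual_repr b _ _
  -- the section
  obtain ⟨S, hSh⟩ := exists_pseudo_inv (dL N η 0)
  have hrep : ∀ (h : solSpace N η) y, h.1 y = h.1 0 +
      ((S (dL N η 0 h)).1 y - (S (dL N η 0 h)).1 0) := by
    intro h y
    have h1 := hzero (h - S (dL N η 0 h)) (by rw [map_sub, hSh, sub_self]) y
    have h2 : h.1 y - (S (dL N η 0 h)).1 y = h.1 0 - (S (dL N η 0 h)).1 0 := h1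
    linarith
  let e : Fin d → (EuclideanSpace ℝ (Fin d) →L[ℝ] ℝ) := fun i => EuclideanSpace.proj i
  have he : ∀ L : EuclideanSpace ℝ (Fin d) →L[ℝ] ℝ,
      L = ∑ i, L (EuclideanSpace.single i 1) • e i := by
    intro L
    ext a
    have hs : a = ∑ i, a i • EuclideanSpace.single i (1:ℝ) := by
      simpa using ((EuclideanSpace.basisFun (Fin d) ℝ).sum_repr a).symm
    conv_lhs => rw [hs]
    simp [e, mul_comm]
  refine ⟨fun x => evL N η 0 (G x),
    fun x => WithLp.toLp 2 fun i => dL N η 0 (G x) (EuclideanSpace.single i 1),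
    fun y => WithLp.toLp 2 fun i => (S (e i)).1 y - (S (e i)).1 0, ?_, ?_, ?_, hqe _, ?_⟩
  · rw [contDiff_euclidean]
    intro i
    exact (S (e i)).2.1.sub contDiff_const
  · ext i; simp
  · intro x hx y
    have h1 := hrep (G x) y
    rw [hG x hx] at h1
    rw [h1]
    congr 1
    · rw [← hG x hx]; rfl
    · rw [he (dL N η 0 (G x))]
      simp only [map_sum, map_smul]
      rw [PiLp.inner_apply]
      have h2 : ∀ z, (∑ i, (dL N η 0 (G x)) (EuclideanSpace.single i 1) • S (e i)).1 z =
          ∑ i, (dL N η 0 (G x)) (EuclideanSpace.single i 1) * (S (e i)).1 z := by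
        intro z
        have := map_sum (evL N η z)
          (fun i => (dL N η 0 (G x)) (EuclideanSpace.single i 1) • S (e i)) Finset.univ
        simp only [map_smul, smul_eq_mul] at this
        exact this
      rw [h2, h2, ← Finset.sum_sub_distrib]
      refine Finset.sum_congr rfl fun i _ => ?_
      simp
      ring
  · intro i
    exact hqe ((ContinuousLinearMap.apply ℝ ℝ
      (EuclideanSpace.single i (1:ℝ))).toLinearMap ∘ₗ dL N η 0)
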